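/- Let A be a symmetric m-th order n-dimensional real tensor all of whose entries are nonnegative. If A is generalized diagonally dominant, i.e., there exists a vector d ∈ ℝ^n with all d_i > 0 such that the tensor B with entries b_{i_1...i_m} = a_{i_1...i_m} d_{i_1}^{1-m} d_{i_2}···d_{i_m} is diagonally dominant (|b_{i...i}| ≥ ∑_{(i_2,...,i_m) ≠ (i,...,i)} |b_{i i_2...i_m}| for every i), then A is doubly nonnegative: all entries of A and all H-eigenvalues of A are nonnegative. -/

import Mathlib

open Finset

/-- `(A x^{m-1})_i = \sum_{i_2,...,i_m} a_{i i_2 ... i_m} x_{i_2} ... x_{i_m}`. -/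
noncomputable def tmulVec {m n : ℕ} [NeZero m] (A : (Fin m → Fin n) → ℝ)
    (x : Fin n → ℝ) (i : Fin n) : ℝ :=
  ∑ g : Fin m → Fin n,
    if g 0 = i then A g * ∏ t ∈ Finset.univ.erase (0 : Fin m), x (g t) else 0

/-- λ is an H-eigenvalue of A if A x^{m-1} = λ x^{[m-1]} for some x ≠ 0. -/
def IsHEigenvalue {m n : ℕ} [NeZero m] (A : (Fin m → Fin n) → ℝ) (lam : ℝ) : Prop :=
  ∃ x : Fin n → ℝ, x ≠ 0 ∧ ∀ i, tmulVec A x i = lam * (x i) ^ (m - 1)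

/-- A tensor is symmetric if its entries are invariant under permutations of the indices. -/
def IsSymmetricTensor {m n : ℕ} (A : (Fin m → Fin n) → ℝ) : Prop :=
  ∀ (σ : Equiv.Perm (Fin m)) (g : Fin m → Fin n), A (g ∘ σ) = A g

/-- Doubly nonnegative: all entries and all H-eigenvalues nonnegative. -/
def IsDNN {m n : ℕ} [NeZero m] (A : (Fin m → Fin n) → ℝ) : Prop :=
  (∀ g, 0 ≤ A g) ∧ ∀ lam : ℝ, IsHEigenvalue A lam → 0 ≤ lam

/-- Diagonally dominant: |a_{i...i}| ≥ sum of |a_{i i_2 ... i_m}| over off-diagonal tuples. -/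
def IsDiagDominant {m n : ℕ} [NeZero m] (A : (Fin m → Fin n) → ℝ) : Prop :=
  ∀ i : Fin n,
    ∑ g ∈ Finset.univ.filter (fun g : Fin m → Fin n => g 0 = i ∧ g ≠ fun _ => i), |A g|
      ≤ |A (fun _ => i)|

/-- Splitting off the diagonal term of `A x^{m-1}`. -/
theorem tmulVec_eq_diag_add {m n : ℕ} [NeZero m] (A : (Fin m → Fin n) → ℝ)
    (x : Fin n → ℝ) (i : Fin n) :
    tmulVec A x i = A (fun _ => i) * x i ^ (m - 1) +
      ∑ g ∈ Finset.univ.filter (fun g : Fin m → Fin n => g 0 = i ∧ g ≠ fun _ => i),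
        A g * ∏ t ∈ Finset.univ.erase (0 : Fin m), x (g t) := by
  have hmem : (fun _ => i) ∈ Finset.univ.filter (fun g : Fin m → Fin n => g 0 = i) := by simp
  have hfilter : Finset.univ.filter (fun g : Fin m → Fin n => g 0 = i ∧ g ≠ fun _ => i) =
      (Finset.univ.filter (fun g : Fin m → Fin n => g 0 = i)).erase (fun _ => i) := by
    ext g
    simp [and_comm]
  rw [tmulVec, ← Finset.sum_filter, ← Finset.add_sum_erase _ _ hmem, hfilter]
  simp

/-- If `|x j| ≤ c * d j` for all `j`, then each degree `m - 1` monomial in `x` is bounded by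
`c ^ (m - 1)` times the same monomial in `d`. -/
theorem abs_prod_erase_le {m n : ℕ} [NeZero m] {x d : Fin n → ℝ} {c : ℝ}
    (h : ∀ j, |x j| ≤ c * d j) (g : Fin m → Fin n) :
    |∏ t ∈ Finset.univ.erase (0 : Fin m), x (g t)| ≤
      c ^ (m - 1) * ∏ t ∈ Finset.univ.erase (0 : Fin m), d (g t) := by
  calc |∏ t ∈ Finset.univ.erase (0 : Fin m), x (g t)|
      = ∏ t ∈ Finset.univ.erase (0 : Fin m), |x (g t)| := Finset.abs_prod _ _
    _ ≤ ∏ t ∈ Finset.univ.erase (0 : Fin m), c * d (g t) :=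
        Finset.prod_le_prod (fun _ _ => abs_nonneg _) fun t _ => h (g t)
    _ = c ^ (m - 1) * ∏ t ∈ Finset.univ.erase (0 : Fin m), d (g t) := by
        simp [Finset.prod_mul_distrib]

/-- a symmetric nonnegative generalized diagonally dominant tensor is
doubly nonnegative. -/
theorem gen_diag_dominant_nonneg_is_DNN (m n : ℕ) [NeZero m] (A : (Fin m → Fin n) → ℝ)
    (hsym : IsSymmetricTensor A) (hnn : ∀ g, 0 ≤ A g)
    (hgdd : ∃ d : Fin n → ℝ, (∀ i, 0 < d i) ∧
      IsDiagDominant (fun g : Fin m → Fin n =>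
        A g * (∏ t ∈ Finset.univ.erase (0 : Fin m), d (g t)) / (d (g 0)) ^ (m - 1))) :
    IsDNN A := by
  refine ⟨hnn, ?_⟩
  rintro lam ⟨x, hx, hlam⟩
  obtain ⟨d, hd, hdom⟩ := hgdd
  obtain ⟨j₀, hj₀⟩ := Function.ne_iff.mp hx
  obtain ⟨i, -, hi⟩ := Finset.exists_max_image Finset.univ (fun j => |x j| / d j) ⟨j₀, mem_univ j₀⟩
  have hc : 0 < |x i| / d i := (div_pos (abs_pos.mpr hj₀) (hd j₀)).trans_le (hi j₀ (mem_univ _))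
  have hxi : 0 < |x i| := (div_pos_iff_of_pos_right (hd i)).mp hc
  have hbound : ∀ j, |x j| ≤ |x i| / d i * d j := fun j =>
    (div_le_iff₀ (hd j)).mp (hi j (mem_univ j))
  have hdi : 0 < d i ^ (m - 1) := pow_pos (hd i) _
  have hoff : |∑ g ∈ Finset.univ.filter (fun g : Fin m → Fin n => g 0 = i ∧ g ≠ fun _ => i),
      A g * ∏ t ∈ Finset.univ.erase (0 : Fin m), x (g t)| ≤
      |x i| ^ (m - 1) * A (fun _ => i) := by
    calc _ ≤ ∑ g ∈ Finset.univ.filter (fun g : Fin m → Fin n => g 0 = i ∧ g ≠ fun _ => i),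
          |A g * ∏ t ∈ Finset.univ.erase (0 : Fin m), x (g t)| := Finset.abs_sum_le_sum_abs _ _
      _ ≤ ∑ g ∈ Finset.univ.filter (fun g : Fin m → Fin n => g 0 = i ∧ g ≠ fun _ => i),
          |x i| ^ (m - 1) *
            |A g * (∏ t ∈ Finset.univ.erase (0 : Fin m), d (g t)) / d (g 0) ^ (m - 1)| := by
        refine Finset.sum_le_sum fun g hg => ?_
        have hg0 : g 0 = i := (Finset.mem_filter.mp hg).2.1
        have hprod : 0 ≤ ∏ t ∈ Finset.univ.erase (0 : Fin m), d (g t) :=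
          Finset.prod_nonneg fun t _ => (hd _).le
        rw [hg0, abs_mul, abs_of_nonneg (hnn g),
          abs_of_nonneg (div_nonneg (mul_nonneg (hnn g) hprod) hdi.le)]
        calc _ ≤ A g * ((|x i| / d i) ^ (m - 1) *
              ∏ t ∈ Finset.univ.erase (0 : Fin m), d (g t)) :=
              mul_le_mul_of_nonneg_left (abs_prod_erase_le hbound g) (hnn g)
          _ = _ := by rw [div_pow]; ring
      _ ≤ |x i| ^ (m - 1) * A (fun _ => i) := by
        rw [← Finset.mul_sum]
        refine mul_le_mul_of_nonneg_left ((hdom i).trans_eq ?_) (by positivity)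
        simp [mul_div_assoc, div_self hdi.ne', abs_of_nonneg (hnn _)]
  have hdiff : |lam - A (fun _ => i)| * |x i| ^ (m - 1) ≤
      A (fun _ => i) * |x i| ^ (m - 1) := by
    rw [← abs_pow, ← abs_mul, sub_mul, ← hlam i, tmulVec_eq_diag_add, add_sub_cancel_left,
      abs_pow, mul_comm (A _)]
    exact hoff
  linarith [(abs_le.mp (le_of_mul_le_mul_right hdiff (pow_pos hxi _))).1]
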